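/- Let M be a simple conical refinement commutative additive monoid. Then exactly one of the following holds: (a) sr(a) = 1 for all a ∈ M; (b) sr(a) = ∞ for all nonzero a ∈ M; (c) the set { sr(a) : a ∈ M, a ≠ 0 } equals the set of all integers ≥ 2. -/

import Mathlib

/-- `a` satisfies the `n`-stable rank condition in `M`. -/
def SRCond {M : Type*} [AddCommMonoid M] (a : M) (n : ℕ) : Prop :=
  ∀ x y : M, n • a + x = a + y → ∃ e : M, n • a = a + e ∧ e + x = y

/-- The stable rank of `a`: the least positive integer `n` such that `a` satisfies
the `n`-stable rank condition, or `∞` if no such `n` exists. -/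
noncomputable def sr {M : Type*} [AddCommMonoid M] (a : M) : ℕ∞ :=
  sInf {n : ℕ∞ | ∃ m : ℕ, 0 < m ∧ SRCond a m ∧ n = (m : ℕ∞)}

section Helpers
variable {M : Type*} [AddCommMonoid M]

theorem SRCond.succ' {a : M} {n : ℕ} (h : SRCond a n) : SRCond a (n + 1) := by
  intro x y hxy
  obtain ⟨e, h1, h2⟩ := h (a + x) y (by rw [← hxy, succ_nsmul]; abel)
  refine ⟨e + a, ?_, ?_⟩
  · rw [succ_nsmul, h1]; abel
  · rw [← h2]; abel

theorem SRCond.mono' {a : M} {n m : ℕ} (h : SRCond a n) (hnm : n ≤ m) : SRCond a m := by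
  induction m, hnm using Nat.le_induction with
  | base => exact h
  | succ k _ ih => exact ih.succ'

theorem sr_eq_of {a : M} {t : ℕ} (h : SRCond a (t + 1)) (h' : t = 0 ∨ ¬ SRCond a t) :
    sr a = ((t + 1 : ℕ) : ℕ∞) := by
  unfold sr
  apply le_antisymm
  · exact sInf_le ⟨t + 1, by omega, h, rfl⟩
  · apply le_sInf
    rintro n ⟨m, hm, hc, rfl⟩
    rcases h' with h' | h'
    · subst h'; exact_mod_cast hm
    · have : t < m := by
        by_contra hlt
        exact h' (hc.mono' (by omega))
      exact_mod_cast this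

theorem sr_eq_top {a : M} (h : ∀ m : ℕ, 0 < m → ¬ SRCond a m) : sr a = ⊤ := by
  unfold sr
  rw [sInf_eq_top]
  rintro n ⟨m, hm, hc, rfl⟩
  exact absurd hc (h m hm)

/-- Peeling off copies of `d`. -/
theorem peel {d : M} {N : ℕ} (h : SRCond d N) (x b : M) (r : ℕ) (hr : N ≤ r) (k : ℕ)
    (he : (r + k) • d + x = k • d + b) : r • d + x = b := by
  induction k with
  | zero => simpa using he
  | succ k ih =>
    apply ih
    obtain ⟨s, rfl⟩ := Nat.exists_eq_add_of_le hr
    obtain ⟨e, h1, h2⟩ := h ((s + k + 1) • d + x) (k • d + b) (by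
      rw [succ_nsmul' d k] at he
      rw [← add_assoc, ← add_nsmul, ← add_assoc d, ← he]
      congr 2; ring)
    rw [← h2]
    have : (N + s + k) • d + x = N • d + (s + k) • d + x := by
      rw [← add_nsmul]; congr 2; ring
    rw [this, h1, succ_nsmul]; abel

theorem sr_mul_of {a : M} {k j : ℕ} (hk : 0 < k) (h : SRCond a (j * k + 1)) :
    SRCond (k • a) (j + 1) := by
  intro x y hxy
  obtain ⟨l, rfl⟩ := Nat.exists_eq_add_of_le' hk
  have h1 : (j * (l + 1) + 1) • a + x = a + y := by
    refine peel h x (a + y) _ le_rfl l ?_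
    rw [← mul_nsmul, succ_nsmul a l] at hxy
    rw [← add_assoc, ← hxy]
    congr 2; ring
  obtain ⟨e, h2, h3⟩ := h _ _ h1
  refine ⟨e, ?_, h3⟩
  rw [← mul_nsmul, succ_nsmul a l, add_assoc, ← h2, ← add_nsmul]
  congr 1; ring

theorem sr_of_mul
    (href : ∀ x1 x2 y1 y2 : M, x1 + x2 = y1 + y2 →
      ∃ z11 z12 z21 z22 : M,
        x1 = z11 + z12 ∧ x2 = z21 + z22 ∧ y1 = z11 + z21 ∧ y2 = z12 + z22)
    {a : M} {k j : ℕ} (hk : 0 < k) (h : SRCond (k • a) (j + 1)) :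
    SRCond a (j * k + 1) := by
  intro x y hxy
  obtain ⟨l, rfl⟩ := Nat.exists_eq_add_of_le' hk
  obtain ⟨z11, z12, z21, z22, h1, h2, h3, h4⟩ := href _ _ _ _ hxy
  have h5 : (j * (l + 1) + 1) • a + z21 = a + z12 := by
    rw [h1, h3]; abel
  obtain ⟨e, _, h7⟩ := h z21 z12 (by
    rw [← mul_nsmul, succ_nsmul a l, add_assoc, ← h5, ← add_assoc, ← add_nsmul]
    congr 2; ring)
  refine ⟨e, ?_, ?_⟩
  · rw [h1, ← h7]
    conv_rhs => rw [h3]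
    abel
  · rw [h2, h4, ← h7]; abel

/-- Finiteness of the stable rank spreads to every nonzero element. -/
theorem finite_spread
    (hsimple : ∀ a : M, a ≠ 0 → ∀ x : M, ∃ n : ℕ, 0 < n ∧ ∃ z : M, x + z = n • a)
    {a b : M} (ha : a ≠ 0) (hb : b ≠ 0) {m : ℕ} (hm : SRCond a m) :
    ∃ N : ℕ, SRCond b N := by
  obtain ⟨k, hk, c, hc⟩ := hsimple a ha b
  have hka : SRCond (k • a) (m + 1) :=
    sr_mul_of hk (hm.mono' (by nlinarith))
  rw [← hc] at hka
  obtain ⟨N, _, w, hw⟩ := hsimple b hb ((m + 1) • (b + c) + c)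
  refine ⟨N, fun x y hxy => ?_⟩
  obtain ⟨e, h1, h2⟩ := hka (c + w + x + c) y (by
    calc (m + 1) • (b + c) + (c + w + x + c)
        = ((m + 1) • (b + c) + c + w) + x + c := by abel
      _ = b + c + y := by rw [hw, hxy]; abel)
  refine ⟨e + w + c + c, ?_, ?_⟩
  · rw [← hw, h1]; abel
  · rw [← h2]; abel

/-- Cancellation of elements dominating enough copies of an element. -/
theorem cancel_big
    (hsimple : ∀ a : M, a ≠ 0 → ∀ x : M, ∃ n : ℕ, 0 < n ∧ ∃ z : M, x + z = n • a)
    {a b c d x : M} (hd : d ≠ 0) {N : ℕ} (hN : SRCond d N) (ha : a = N • d + x)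
    (h : a + c = b + c) : a = b := by
  obtain ⟨k, _, z, hz⟩ := hsimple d hd c
  rw [ha]
  refine peel hN x b N le_rfl k ?_
  calc (N + k) • d + x = (N • d + x) + k • d := by rw [add_nsmul]; abel
    _ = (a + c) + z := by rw [← hz, ← ha]; abel
    _ = k • d + b := by rw [h, ← hz]; abel

theorem one_of_cancel {a : M} (h : ∀ x y : M, a + x = a + y → x = y) : SRCond a 1 := by
  intro x y hxy
  rw [one_nsmul] at hxy
  exact ⟨0, by simp, by rw [zero_add]; exact h _ _ hxy⟩

theorem cancel_of_one (hconical : ∀ x y : M, x + y = 0 → x = 0 ∧ y = 0)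
    {a : M} (h : SRCond a 1) : ∀ x y : M, a + x = a + y → x = y := by
  intro x y hxy
  obtain ⟨e, h1, h2⟩ := h x y (by rw [one_nsmul]; exact hxy)
  obtain ⟨f, _, h4⟩ := h e 0 (by rw [one_nsmul] at h1 ⊢; rw [add_zero, ← h1])
  have := (hconical _ _ h4).2
  rw [← h2, this, zero_add]

theorem one_spread (hconical : ∀ x y : M, x + y = 0 → x = 0 ∧ y = 0)
    (hsimple : ∀ a : M, a ≠ 0 → ∀ x : M, ∃ n : ℕ, 0 < n ∧ ∃ z : M, x + z = n • a)
    {a : M} (ha : a ≠ 0) (h : SRCond a 1) (b : M) : SRCond b 1 := by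
  apply one_of_cancel
  have hc := cancel_of_one hconical h
  have hn : ∀ n : ℕ, ∀ x y : M, n • a + x = n • a + y → x = y := by
    intro n
    induction n with
    | zero => intro x y hxy; simpa using hxy
    | succ n ih =>
      intro x y hxy
      rw [succ_nsmul, add_assoc, add_assoc] at hxy
      exact hc _ _ (ih _ _ hxy)
  obtain ⟨k, _, z, hz⟩ := hsimple a ha b
  intro x y hxy
  apply hn k
  rw [← hz]
  calc b + z + x = (b + x) + z := by abel
    _ = b + z + y := by rw [hxy]; abel

theorem atom_one
    (href : ∀ x1 x2 y1 y2 : M, x1 + x2 = y1 + y2 →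
      ∃ z11 z12 z21 z22 : M,
        x1 = z11 + z12 ∧ x2 = z21 + z22 ∧ y1 = z11 + z21 ∧ y2 = z12 + z22)
    {p : M} (hp : p ≠ 0) (hat : ∀ x y : M, p = x + y → x = 0 ∨ y = 0) : SRCond p 1 := by
  apply one_of_cancel
  intro x y hxy
  obtain ⟨z11, z12, z21, z22, h1, h2, h3, h4⟩ := href _ _ _ _ hxy
  rcases hat _ _ h1 with h | h
  · rw [h, zero_add] at h1 h3
    rw [h2, h4, ← h1, ← h3]
  · rcases hat _ _ h3 with h' | h'
    · exact absurd (by rw [h1, h, h', add_zero]) hp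
    · rw [h2, h4, h, h']

theorem small_below
    (href : ∀ x1 x2 y1 y2 : M, x1 + x2 = y1 + y2 →
      ∃ z11 z12 z21 z22 : M,
        x1 = z11 + z12 ∧ x2 = z21 + z22 ∧ y1 = z11 + z21 ∧ y2 = z12 + z22)
    {x : M} (n : ℕ) : ∀ y : M, y ≠ 0 → (∃ z, y + z = n • x) →
      ∃ d, d ≠ 0 ∧ (∃ u, x = d + u) ∧ ∃ v, y = d + v ∨ (n = 0 ∧ y + v = 0) := by
  induction n with
  | zero =>
    rintro y hy ⟨z, hz⟩
    by_cases hx : x = 0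
    · exact ⟨y, hy, ⟨z, by rw [hx, hz, zero_nsmul]⟩, 0, Or.inl (by simp)⟩
    · exact ⟨x, hx, ⟨0, by simp⟩, z, Or.inr ⟨rfl, by simpa using hz⟩⟩
  | succ n ih =>
    rintro y hy ⟨z, hz⟩
    rw [succ_nsmul] at hz
    obtain ⟨z11, z12, z21, z22, h1, h2, h3, h4⟩ := href _ _ _ _ hz
    by_cases h : z12 = 0
    · have hy' : z11 ≠ 0 := by
        rintro h'; exact hy (by rw [h1, h, h', add_zero])
      obtain ⟨d, hd, hu, v, hv⟩ := ih z11 hy' ⟨z21, h3.symm⟩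
      rcases hv with hv | ⟨hn, hv⟩
      · exact ⟨d, hd, hu, v, Or.inl (by rw [h1, h, hv, add_zero])⟩
      · subst hn
        have h5 : z11 + z21 = 0 := by rw [← h3, zero_nsmul]
        refine ⟨z11, hy', ⟨z21 + x, ?_⟩, 0, Or.inl ?_⟩
        · rw [← add_assoc, h5, zero_add]
        · rw [h1, h]
    · exact ⟨z12, h, ⟨z22, h4⟩, z11, Or.inl (by rw [h1, add_comm])⟩

theorem half
    (hconical : ∀ x y : M, x + y = 0 → x = 0 ∧ y = 0)
    (href : ∀ x1 x2 y1 y2 : M, x1 + x2 = y1 + y2 →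
      ∃ z11 z12 z21 z22 : M,
        x1 = z11 + z12 ∧ x2 = z21 + z22 ∧ y1 = z11 + z21 ∧ y2 = z12 + z22)
    (hsimple : ∀ a : M, a ≠ 0 → ∀ x : M, ∃ n : ℕ, 0 < n ∧ ∃ z : M, x + z = n • a)
    (hno : ∀ a : M, a ≠ 0 → ¬ SRCond a 1) (N : ℕ) :
    ∀ a : M, a ≠ 0 → ∃ d x : M, d ≠ 0 ∧ a = N • d + x := by
  have key : ∀ a : M, a ≠ 0 → ∃ d x : M, d ≠ 0 ∧ a = 2 • d + x := by
    intro a ha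
    have : ∃ x y : M, a = x + y ∧ x ≠ 0 ∧ y ≠ 0 := by
      by_contra hcon
      push Not at hcon
      refine hno a ha (atom_one href ha fun x y h => ?_)
      by_cases hx : x = 0
      · exact Or.inl hx
      · exact Or.inr (hcon x y h hx)
    obtain ⟨x, y, h, hx, hy⟩ := this
    obtain ⟨n, hn, z, hz⟩ := hsimple x hx y
    obtain ⟨d, hd, ⟨u, hu⟩, v, hv | ⟨h0, _⟩⟩ := small_below href n y hy ⟨z, hz⟩
    · exact ⟨d, u + v, hd, by rw [h, hu, hv, two_nsmul]; abel⟩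
    · omega
  have pow : ∀ k : ℕ, ∀ a : M, a ≠ 0 → ∃ d x : M, d ≠ 0 ∧ a = (2 ^ k) • d + x := by
    intro k
    induction k with
    | zero => intro a ha; exact ⟨a, 0, ha, by simp⟩
    | succ k ih =>
      intro a ha
      obtain ⟨d, x, hd, h⟩ := ih a ha
      obtain ⟨d', x', hd', h'⟩ := key d hd
      refine ⟨d', 2 ^ k • x' + x, hd', ?_⟩
      rw [h, h', nsmul_add, ← mul_nsmul, pow_succ, mul_comm 2, add_assoc]
  intro a ha
  obtain ⟨d, x, hd, h⟩ := pow N a ha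
  obtain ⟨s, hs⟩ := Nat.exists_eq_add_of_le (Nat.lt_two_pow_self (n := N)).le
  exact ⟨d, s • d + x, hd, by rw [h, hs, add_nsmul, add_assoc]⟩

theorem unbounded
    (hconical : ∀ x y : M, x + y = 0 → x = 0 ∧ y = 0)
    (href : ∀ x1 x2 y1 y2 : M, x1 + x2 = y1 + y2 →
      ∃ z11 z12 z21 z22 : M,
        x1 = z11 + z12 ∧ x2 = z21 + z22 ∧ y1 = z11 + z21 ∧ y2 = z12 + z22)
    (hnz : ∃ x : M, x ≠ 0)
    (hsimple : ∀ a : M, a ≠ 0 → ∀ x : M, ∃ n : ℕ, 0 < n ∧ ∃ z : M, x + z = n • a)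
    (hno : ∀ a : M, a ≠ 0 → ¬ SRCond a 1) (N : ℕ) :
    ∃ d : M, d ≠ 0 ∧ ¬ SRCond d N := by
  by_contra hcon
  push Not at hcon
  obtain ⟨p, hp⟩ := hnz
  have hc : ∀ a b c : M, a ≠ 0 → a + c = b + c → a = b := by
    intro a b c ha h
    obtain ⟨d, x, hd, hx⟩ := half hconical href hsimple hno N a ha
    exact cancel_big hsimple hd (hcon d hd) hx h
  refine hno p hp (one_of_cancel fun x y hxy => ?_)
  by_cases hx : x = 0
  · by_cases hy : y = 0
    · rw [hx, hy]
    · exact (hc y x p hy (by rw [add_comm, ← hxy, add_comm])).symm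
  · exact hc x y p hx (by rw [add_comm, hxy, add_comm])

theorem attain
    (hconical : ∀ x y : M, x + y = 0 → x = 0 ∧ y = 0)
    (href : ∀ x1 x2 y1 y2 : M, x1 + x2 = y1 + y2 →
      ∃ z11 z12 z21 z22 : M,
        x1 = z11 + z12 ∧ x2 = z21 + z22 ∧ y1 = z11 + z21 ∧ y2 = z12 + z22)
    (hnz : ∃ x : M, x ≠ 0)
    (hsimple : ∀ a : M, a ≠ 0 → ∀ x : M, ∃ n : ℕ, 0 < n ∧ ∃ z : M, x + z = n • a)
    (hno : ∀ a : M, a ≠ 0 → ¬ SRCond a 1)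
    (hfin : ∀ a : M, a ≠ 0 → ∃ n, SRCond a n) (j : ℕ) :
    ∃ a : M, a ≠ 0 ∧ sr a = ((j + 2 : ℕ) : ℕ∞) := by
  classical
  obtain ⟨b, hb, hbn⟩ := unbounded hconical href hnz hsimple hno ((j + 1) ^ 2 + 1)
  -- minimal `n`
  have hex := hfin b hb
  have hmin := Nat.find_spec hex
  have hlt : ∀ m, m < Nat.find hex → ¬ SRCond b m := fun m hm => Nat.find_min hex hm
  have hbig : (j + 1) ^ 2 + 1 < Nat.find hex := by
    by_contra h
    exact hbn (hmin.mono' (by omega))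
  obtain ⟨s, hs⟩ : ∃ s, Nat.find hex = s + 1 := ⟨Nat.find hex - 1, by omega⟩
  rw [hs] at hmin hlt hbig
  obtain ⟨k, hk1, hk2⟩ : ∃ k, s ≤ (j + 1) * k ∧ (j + 1) * k ≤ s + j := by
    refine ⟨(s + j) / (j + 1), ?_, Nat.mul_div_le _ _⟩
    have := Nat.lt_mul_div_succ (s + j) (Nat.succ_pos j)
    rw [Nat.succ_eq_add_one, mul_add] at this
    omega
  have hk0 : 0 < k := by
    rcases Nat.eq_zero_or_pos k with h | h
    · subst h; nlinarith
    · exact h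
  have hjk : j * k < s := by nlinarith
  refine ⟨k • b, ?_, sr_eq_of (t := j + 1) ?_ (Or.inr ?_)⟩
  · obtain ⟨l, rfl⟩ := Nat.exists_eq_add_of_le' hk0
    intro h
    rw [succ_nsmul] at h
    exact hb (hconical _ _ h).2
  · exact sr_mul_of hk0 (hmin.mono' (by omega))
  · intro h
    exact hlt _ (by omega) (sr_of_mul href hk0 h)

end Helpers

theorem stmt_19 {M : Type*} [AddCommMonoid M]
    (hconical : ∀ x y : M, x + y = 0 → x = 0 ∧ y = 0)
    (href : ∀ x1 x2 y1 y2 : M, x1 + x2 = y1 + y2 →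
      ∃ z11 z12 z21 z22 : M,
        x1 = z11 + z12 ∧ x2 = z21 + z22 ∧ y1 = z11 + z21 ∧ y2 = z12 + z22)
    (hnz : ∃ x : M, x ≠ 0)
    (hsimple : ∀ a : M, a ≠ 0 → ∀ x : M, ∃ n : ℕ, 0 < n ∧ ∃ z : M, x + z = n • a) :
    ((∀ a : M, sr a = 1) ∧ ¬ (∀ a : M, a ≠ 0 → sr a = ⊤) ∧
        ¬ (sr '' {x : M | x ≠ 0} = {n : ℕ∞ | 2 ≤ n ∧ n < ⊤})) ∨
    (¬ (∀ a : M, sr a = 1) ∧ (∀ a : M, a ≠ 0 → sr a = ⊤) ∧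
        ¬ (sr '' {x : M | x ≠ 0} = {n : ℕ∞ | 2 ≤ n ∧ n < ⊤})) ∨
    (¬ (∀ a : M, sr a = 1) ∧ ¬ (∀ a : M, a ≠ 0 → sr a = ⊤) ∧
        (sr '' {x : M | x ≠ 0} = {n : ℕ∞ | 2 ≤ n ∧ n < ⊤})) := by
  obtain ⟨p, hp⟩ := id hnz
  by_cases h1 : ∃ a : M, a ≠ 0 ∧ SRCond a 1
  · obtain ⟨a, ha, h⟩ := h1
    have hall : ∀ b : M, sr b = 1 := by
      intro b
      have := sr_eq_of (t := 0) (one_spread hconical hsimple ha h b) (Or.inl rfl)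
      simpa using this
    refine Or.inl ⟨hall, fun h' => ?_, fun h' => ?_⟩
    · have := h' p hp
      rw [hall] at this
      exact absurd this (by simp)
    · have : sr p ∈ {n : ℕ∞ | 2 ≤ n ∧ n < ⊤} := h' ▸ ⟨p, hp, rfl⟩
      rw [hall] at this
      exact absurd this.1 (by decide)
  have hno : ∀ a : M, a ≠ 0 → ¬ SRCond a 1 := fun a ha h => h1 ⟨a, ha, h⟩
  by_cases h2 : ∃ a : M, a ≠ 0 ∧ ∃ m, SRCond a m
  · obtain ⟨a, ha, m, hm⟩ := h2
    have hfin : ∀ b : M, b ≠ 0 → ∃ n, SRCond b n := fun b hb =>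
      finite_spread hsimple ha hb hm
    have himg : sr '' {x : M | x ≠ 0} = {n : ℕ∞ | 2 ≤ n ∧ n < ⊤} := by
      ext n
      constructor
      · rintro ⟨b, hb, rfl⟩
        constructor
        · apply le_sInf
          rintro n ⟨k, hk, hc, rfl⟩
          have : 2 ≤ k := by
            by_contra h
            exact hno b hb (hc.mono' (by omega))
          exact_mod_cast this
        · obtain ⟨n, hn⟩ := hfin b hb
          exact lt_of_le_of_lt (sInf_le ⟨n + 1, by omega, hn.succ', rfl⟩)
            (ENat.natCast_lt_top _)
      · rintro ⟨hn2, hnt⟩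
        lift n to ℕ using hnt.ne
        have hn2' : 2 ≤ n := by exact_mod_cast hn2
        obtain ⟨j, rfl⟩ := Nat.exists_eq_add_of_le' hn2'
        obtain ⟨b, hb, hsr⟩ := attain hconical href hnz hsimple hno hfin j
        exact ⟨b, hb, hsr⟩
    have hpm : sr p ∈ {n : ℕ∞ | 2 ≤ n ∧ n < ⊤} := himg ▸ ⟨p, hp, rfl⟩
    refine Or.inr (Or.inr ⟨fun h' => ?_, fun h' => ?_, himg⟩)
    · rw [h' p] at hpm
      exact absurd hpm.1 (by decide)
    · exact hpm.2.ne (h' p hp)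
  · have hall : ∀ a : M, a ≠ 0 → sr a = ⊤ := fun a ha =>
      sr_eq_top fun m _ h => h2 ⟨a, ha, m, h⟩
    refine Or.inr (Or.inl ⟨fun h' => ?_, hall, fun h' => ?_⟩)
    · have := h' p
      rw [hall p hp] at this
      exact absurd this (by simp)
    · have hpm : sr p ∈ {n : ℕ∞ | 2 ≤ n ∧ n < ⊤} := h' ▸ ⟨p, hp, rfl⟩
      exact hpm.2.ne (hall p hp)
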